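/- arXiv:2212.03171 — 5 statements merged into one kernel-verified Lean document; each statement's English description precedes it below -/
import Mathlib

section
/- Let I ⊂ ℝ be an open interval, k ∈ ℕ, a ∈ C^k(I, ℂ), λ ∈ ℂ \ {0}, and x₀, x ∈ I. Then for every N ≤ k with N ≥ 1, a(x) = Σ_{j=0}^{N−1} (1/j!) (D^{λ,(j)}a)(x₀) (e^{λ(x−x₀)} − 1)^j + R_N(x,x₀), where R_N(x,x₀) = (λ/(N−1)!) ∫_0^1 (D^{λ,(N)}a)((1−θ)x₀ + θx) (e^{λ(1−θ)(x−x₀)} − 1)^{N−1} (x−x₀) dθ. -/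
open Complex Filter Finset Nat

/-- The differential operators `D^{λ,(j)}` acting on functions `ℝ → ℂ`:
`D^{λ,(0)} = Id` and `D^{λ,(j+1)} = ((1/λ)·d/dx − j·Id) ∘ D^{λ,(j)}`. -/
noncomputable def expD (lam : ℂ) : ℕ → (ℝ → ℂ) → (ℝ → ℂ)
  | 0, a => a
  | (j + 1), a => fun x =>
      (1 / lam) * deriv (expD lam j a) x - (j : ℂ) * expD lam j a x

theorem contDiffOn_expD {I : Set ℝ} (hI : IsOpen I) {k : ℕ} {a : ℝ → ℂ}
    (ha : ContDiffOn ℝ k a I) (lam : ℂ) {j m : ℕ} (hjm : j + m ≤ k) :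
    ContDiffOn ℝ m (expD lam j a) I := by
  induction j generalizing m with
  | zero => exact ha.of_le (by exact_mod_cast (by omega : m ≤ k))
  | succ j ih =>
    have hsucc : ContDiffOn ℝ (m + 1 : ℕ) (expD lam j a) I := ih (by omega)
    have hderiv : ContDiffOn ℝ m (deriv (expD lam j a)) I :=
      hsucc.deriv_of_isOpen hI (by norm_cast)
    exact (contDiffOn_const.mul hderiv).sub (contDiffOn_const.mul (ih (by omega)))

theorem hasDerivAt_expD {I : Set ℝ} (hI : IsOpen I) {k : ℕ} {a : ℝ → ℂ}
    (ha : ContDiffOn ℝ k a I) {lam : ℂ} (hlam : lam ≠ 0) {j : ℕ} (hj : j < k)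
    {t : ℝ} (ht : t ∈ I) :
    HasDerivAt (expD lam j a) (lam * (expD lam (j + 1) a t + j * expD lam j a t)) t := by
  have hdiff : DifferentiableAt ℝ (expD lam j a) t :=
    ((contDiffOn_expD hI ha lam (m := 1) hj).differentiableOn (by norm_num)).differentiableAt
      (hI.mem_nhds ht)
  refine hdiff.hasDerivAt.congr_deriv ?_
  simp only [expD]
  field_simp
  ring

theorem hasDerivAt_exp_sub_one (lam : ℂ) (x t : ℝ) :
    HasDerivAt (fun s : ℝ => Complex.exp (lam * (x - s)) - 1)
      (-(lam * Complex.exp (lam * (x - t)))) t := by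
  have h : HasDerivAt (fun s : ℝ => lam * ((x : ℂ) - s)) (lam * (-1)) t :=
    ((Complex.ofRealCLM.hasDerivAt (x := t)).const_sub (x : ℂ)).const_mul lam
  refine (h.cexp.sub_const 1).congr_deriv ?_
  ring

/-- The derivative in the base point of the exponential Taylor sum telescopes. -/
theorem hasDerivAt_exp_taylor_sum {I : Set ℝ} (hI : IsOpen I) {k : ℕ} {a : ℝ → ℂ}
    (ha : ContDiffOn ℝ k a I) {lam : ℂ} (hlam : lam ≠ 0) (x : ℝ) {n : ℕ} (hn : n < k)
    {t : ℝ} (ht : t ∈ I) :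
    HasDerivAt (fun s : ℝ => ∑ j ∈ Finset.range (n + 1),
        (1 / (j ! : ℂ)) * expD lam j a s * (Complex.exp (lam * (x - s)) - 1) ^ j)
      (lam / (n ! : ℂ) * (expD lam (n + 1) a t * (Complex.exp (lam * (x - t)) - 1) ^ n)) t := by
  induction n with
  | zero => simpa using hasDerivAt_expD hI ha hlam hn ht
  | succ n ih =>
    simp only [Finset.sum_range_succ _ (n + 1)]
    have hterm := ((hasDerivAt_expD hI ha hlam hn ht).const_mul (1 / ((n + 1)! : ℂ))).mul
      ((hasDerivAt_exp_sub_one lam x t).pow (n + 1))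
    refine ((ih (by omega)).add hterm).congr_deriv ?_
    have hfact : (n ! : ℂ) ≠ 0 := by exact_mod_cast n.factorial_ne_zero
    have hcast : (n : ℂ) + 1 ≠ 0 := by exact_mod_cast n.succ_ne_zero
    simp only [Nat.factorial_succ, Nat.cast_mul, Nat.cast_add, Nat.cast_one,
      Nat.add_sub_cancel, Pi.pow_apply]
    field_simp
    ring

theorem exp_taylor_with_integral_remainder
    (I : Set ℝ) (hI : IsOpen I) (hI' : I.OrdConnected)
    (k : ℕ) (a : ℝ → ℂ) (ha : ContDiffOn ℝ k a I)
    (lam : ℂ) (hlam : lam ≠ 0)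
    (x₀ x : ℝ) (hx₀ : x₀ ∈ I) (hx : x ∈ I)
    (N : ℕ) (hN : N ≤ k) (hN1 : 1 ≤ N) :
    a x = ∑ j ∈ Finset.range N,
        (1 / (j ! : ℂ)) * expD lam j a x₀ * (Complex.exp (lam * (x - x₀)) - 1) ^ j
      + (lam / ((N - 1)! : ℂ)) *
        ∫ θ in (0:ℝ)..1,
          expD lam N a ((1 - θ) * x₀ + θ * x) *
            (Complex.exp (lam * (1 - θ) * (x - x₀)) - 1) ^ (N - 1) * ((x : ℂ) - x₀) := by
  obtain ⟨n, rfl⟩ : ∃ n, N = n + 1 := ⟨N - 1, by omega⟩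
  rw [Nat.add_sub_cancel]
  have hmem : ∀ θ ∈ Set.uIcc (0 : ℝ) 1, (1 - θ) * x₀ + θ * x ∈ I := by
    intro θ hθ
    rw [Set.uIcc_of_le zero_le_one] at hθ
    exact hI'.convex hx₀ hx (sub_nonneg.2 hθ.2) hθ.1 (by ring)
  have hpath : ∀ θ : ℝ, HasDerivAt (fun θ : ℝ => (1 - θ) * x₀ + θ * x) (x - x₀) θ := by
    intro θ
    refine ((((hasDerivAt_id θ).const_sub 1).mul_const x₀).add
      ((hasDerivAt_id θ).mul_const x)).congr_deriv ?_
    ring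
  have hderiv : ∀ θ ∈ Set.uIcc (0 : ℝ) 1, HasDerivAt
      (fun θ : ℝ => ∑ j ∈ Finset.range (n + 1), (1 / (j ! : ℂ)) *
        expD lam j a ((1 - θ) * x₀ + θ * x) *
          (Complex.exp (lam * (x - ((1 - θ) * x₀ + θ * x : ℝ))) - 1) ^ j)
      ((lam / (n ! : ℂ)) * (expD lam (n + 1) a ((1 - θ) * x₀ + θ * x) *
        (Complex.exp (lam * (1 - θ) * (x - x₀)) - 1) ^ n * ((x : ℂ) - x₀))) θ := by
    intro θ hθ
    have h := (hasDerivAt_exp_taylor_sum hI ha hlam x hN (hmem θ hθ)).scomp θ (hpath θ)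
    refine h.congr_deriv ?_
    have harg : lam * ((x : ℂ) - ((1 - θ) * x₀ + θ * x : ℝ)) = lam * (1 - θ) * (x - x₀) := by
      push_cast
      ring
    rw [harg, Complex.real_smul]
    push_cast
    ring
  have hcont : ContinuousOn (fun θ : ℝ => expD lam (n + 1) a ((1 - θ) * x₀ + θ * x))
      (Set.uIcc 0 1) :=
    (contDiffOn_expD hI ha lam (m := 0) hN).continuousOn.comp (by fun_prop) hmem
  have hint := intervalIntegral.integral_eq_sub_of_hasDerivAt hderiv
    (ContinuousOn.intervalIntegrable (by fun_prop))
  rw [intervalIntegral.integral_const_mul] at hint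
  rw [hint]
  simp [Finset.sum_range_succ', expD]
end

section
/- Let λ ∈ ℂ \ {0}, x₀, x ∈ ℝ, and a ∈ C^∞(ℝ, ℂ). If (1/(N−1)!) · sup_{ξ ∈ [[x₀,x]]} |(D^{λ,(N)}a)(ξ) (e^{λ(x−ξ)} − 1)^{N−1}| → 0 as N → ∞, where [[x₀,x]] is the segment between x₀ and x, then a(x) = Σ_{j=0}^{∞} (1/j!) (D^{λ,(j)}a)(x₀) (e^{λ(x−x₀)} − 1)^j, the series converging. -/
open Complex Filter Finset Nat

theorem contDiff_expD (lam : ℂ) {a : ℝ → ℂ} (ha : ContDiff ℝ (⊤ : ℕ∞) a) (j : ℕ) :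
    ContDiff ℝ (⊤ : ℕ∞) (expD lam j a) := by
  induction j with
  | zero => exact ha
  | succ j ih =>
    have h := (contDiff_infty_iff_deriv.1 ih).2
    exact (contDiff_const.mul h).sub (contDiff_const.mul ih)

theorem hasDerivAt_expD_s3 {lam : ℂ} (hlam : lam ≠ 0) {a : ℝ → ℂ}
    (ha : ContDiff ℝ (⊤ : ℕ∞) a) (j : ℕ) (ξ : ℝ) :
    HasDerivAt (expD lam j a) (lam * (expD lam (j + 1) a ξ + j * expD lam j a ξ)) ξ := by
  have h := ((contDiff_expD lam ha j).differentiable (by simp) ξ).hasDerivAt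
  refine h.congr_deriv ?_
  simp only [expD]
  field_simp
  ring

theorem hasDerivAt_exp_sub_one_pow (lam : ℂ) (x : ℝ) (j : ℕ) (ξ : ℝ) :
    HasDerivAt (fun ξ : ℝ => (Complex.exp (lam * (x - ξ)) - 1) ^ j)
      (j * (Complex.exp (lam * (x - ξ)) - 1) ^ (j - 1) *
        (-lam * Complex.exp (lam * (x - ξ)))) ξ := by
  have h : HasDerivAt (fun ξ : ℝ => lam * ((x : ℂ) - ξ)) (lam * (-1)) ξ :=
    ((Complex.ofRealCLM.hasDerivAt (x := ξ)).const_sub (x : ℂ)).const_mul lam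
  refine ((h.cexp.sub_const 1).pow j).congr_deriv ?_
  ring

/-- The exponential Taylor polynomial, as a function of its base point, has telescoping
derivative. -/
theorem hasDerivAt_sum_expD {lam : ℂ} (hlam : lam ≠ 0) {a : ℝ → ℂ}
    (ha : ContDiff ℝ (⊤ : ℕ∞) a) (x : ℝ) (n : ℕ) (ξ : ℝ) :
    HasDerivAt
      (fun ξ : ℝ => ∑ j ∈ Finset.range (n + 1),
        (1 / (j ! : ℂ)) * expD lam j a ξ * (Complex.exp (lam * (x - ξ)) - 1) ^ j)
      (lam * ((1 / (n ! : ℂ)) *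
        (expD lam (n + 1) a ξ * (Complex.exp (lam * (x - ξ)) - 1) ^ n))) ξ := by
  induction n with
  | zero => simpa [expD] using hasDerivAt_expD_s3 hlam ha 0 ξ
  | succ n ih =>
    have h := ih.add (((hasDerivAt_expD_s3 hlam ha (n + 1) ξ).const_mul
      (1 / ((n + 1)! : ℂ))).mul (hasDerivAt_exp_sub_one_pow lam x (n + 1) ξ))
    simp only [Finset.sum_range_succ _ (n + 1)]
    refine h.congr_deriv ?_
    have hn : (n ! : ℂ) ≠ 0 := by exact_mod_cast Nat.factorial_ne_zero n
    have hn' : (n : ℂ) + 1 ≠ 0 := by exact_mod_cast Nat.succ_ne_zero n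
    rw [Nat.factorial_succ]
    push_cast
    field_simp
    ring

theorem le_biSup_of_continuous_of_isCompact {s : Set ℝ} (hs : IsCompact s) {f : ℝ → ℝ}
    (hf : Continuous f) (hf0 : ∀ ξ, 0 ≤ f ξ) {ξ : ℝ} (hξ : ξ ∈ s) :
    f ξ ≤ ⨆ η ∈ s, f η := by
  obtain ⟨C, hC⟩ := hs.bddAbove_image hf.continuousOn
  have hb : BddAbove (Set.range fun η => ⨆ _ : η ∈ s, f η) := by
    refine ⟨C, ?_⟩
    rintro _ ⟨η, rfl⟩
    by_cases hη : η ∈ s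
    · simpa [hη] using hC ⟨η, hη, rfl⟩
    · simpa [hη] using (hf0 ξ).trans (hC ⟨ξ, hξ, rfl⟩)
  simpa [hξ] using le_ciSup hb ξ

theorem norm_sub_sum_expD_le {lam : ℂ} (hlam : lam ≠ 0) (x₀ x : ℝ) {a : ℝ → ℂ}
    (ha : ContDiff ℝ (⊤ : ℕ∞) a) (n : ℕ) :
    ‖a x - ∑ j ∈ Finset.range (n + 1),
        (1 / (j ! : ℂ)) * expD lam j a x₀ * (Complex.exp (lam * (x - x₀)) - 1) ^ j‖ ≤
      ‖lam‖ * ((1 / (n ! : ℝ)) * ⨆ ξ ∈ Set.uIcc x₀ x,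
        ‖expD lam (n + 1) a ξ * (Complex.exp (lam * (x - ξ)) - 1) ^ n‖) * ‖x - x₀‖ := by
  have hcont : Continuous fun ξ : ℝ =>
      ‖expD lam (n + 1) a ξ * (Complex.exp (lam * (x - ξ)) - 1) ^ n‖ := by
    have := (contDiff_expD lam ha (n + 1)).continuous
    fun_prop
  have h := Convex.norm_image_sub_le_of_norm_hasDerivWithin_le
    (fun ξ _ => (hasDerivAt_sum_expD hlam ha x n ξ).hasDerivWithinAt)
    (C := ‖lam‖ * ((1 / (n ! : ℝ)) * ⨆ ξ ∈ Set.uIcc x₀ x,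
        ‖expD lam (n + 1) a ξ * (Complex.exp (lam * (x - ξ)) - 1) ^ n‖))
    (fun ξ hξ => by
      rw [norm_mul, norm_mul (1 / (n ! : ℂ))]
      have hsup := le_biSup_of_continuous_of_isCompact isCompact_uIcc hcont
        (fun _ => norm_nonneg _) hξ
      have hfac : ‖1 / (n ! : ℂ)‖ = 1 / (n ! : ℝ) := by simp
      rw [hfac]
      gcongr)
    (convex_uIcc x₀ x) Set.left_mem_uIcc Set.right_mem_uIcc
  have hx : ∑ j ∈ Finset.range (n + 1),
      (1 / (j ! : ℂ)) * expD lam j a x * (Complex.exp (lam * (x - x)) - 1) ^ j = a x := by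
    simp [Finset.sum_range_succ', expD]
  rwa [hx] at h

theorem exp_taylor_series_converges_of_remainder_tendsto_zero
    (lam : ℂ) (hlam : lam ≠ 0) (x₀ x : ℝ)
    (a : ℝ → ℂ) (ha : ContDiff ℝ (⊤ : ℕ∞) a)
    (hrem : Tendsto
      (fun N : ℕ => (1 / ((N - 1)! : ℝ)) *
        ⨆ ξ ∈ Set.uIcc x₀ x,
          ‖expD lam N a ξ * (Complex.exp (lam * (x - ξ)) - 1) ^ (N - 1)‖)
      atTop (nhds 0)) :
    Tendsto
      (fun N : ℕ => ∑ j ∈ Finset.range N,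
        (1 / (j ! : ℂ)) * expD lam j a x₀ * (Complex.exp (lam * (x - x₀)) - 1) ^ j)
      atTop (nhds (a x)) := by
  rw [← tendsto_add_atTop_iff_nat 1] at hrem ⊢
  rw [tendsto_iff_norm_sub_tendsto_zero]
  refine squeeze_zero (fun _ => norm_nonneg _)
    (fun n => (norm_sub_rev _ _).trans_le (norm_sub_sum_expD_le hlam x₀ x ha n)) ?_
  simpa using (hrem.const_mul ‖lam‖).mul_const ‖x - x₀‖
end

section
/- Let a(x) = cos(2πx) (as a function ℝ → ℂ) and λ = 2πi. Then (D^{2πi,(0)}a)(x) = cos(2πx), (D^{2πi,(1)}a)(x) = i·sin(2πx), and for every j ≥ 2, (D^{2πi,(j)}a)(x) = ((−1)^j / 2) · j! · e^{−2πix}, for all x ∈ ℝ. -/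
open Complex Filter Finset Nat

theorem deriv_exp_combination (lam c d : ℂ) (x : ℝ) :
    deriv (fun t : ℝ => c * Complex.exp (lam * t) + d * Complex.exp (-(lam * t))) x
      = lam * (c * Complex.exp (lam * x) - d * Complex.exp (-(lam * x))) := by
  have h : HasDerivAt (fun t : ℝ => lam * (t : ℂ)) lam x := by
    simpa using (Complex.ofRealCLM.hasDerivAt (x := x)).const_mul lam
  have hsum := (h.cexp.const_mul c).add (h.neg.cexp.const_mul d)
  refine HasDerivAt.deriv (hsum.congr_deriv ?_)
  simp only [Pi.neg_apply]
  ring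

/-- On a combination of `e^{λx}` and `e^{-λx}`, one step of the recursion acts diagonally, with
eigenvalues `1 - j` and `-(1 + j)`. -/
theorem expD_succ_of_eq_exp_combination {lam : ℂ} (hlam : lam ≠ 0) {j : ℕ} {a : ℝ → ℂ} {c d : ℂ}
    (h : ∀ x : ℝ, expD lam j a x
      = c * Complex.exp (lam * x) + d * Complex.exp (-(lam * x))) (x : ℝ) :
    expD lam (j + 1) a x
      = (1 - j) * c * Complex.exp (lam * x) + -(1 + j) * d * Complex.exp (-(lam * x)) := by
  rw [expD, funext h]
  beta_reduce
  rw [deriv_exp_combination]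
  field_simp
  ring

theorem expD_cos_two_pi
    (a : ℝ → ℂ) (ha : ∀ x : ℝ, a x = Real.cos (2 * Real.pi * x)) :
    (∀ x : ℝ, expD (2 * Real.pi * Complex.I) 0 a x = Real.cos (2 * Real.pi * x))
    ∧ (∀ x : ℝ, expD (2 * Real.pi * Complex.I) 1 a x
        = Complex.I * Real.sin (2 * Real.pi * x))
    ∧ (∀ j : ℕ, 2 ≤ j → ∀ x : ℝ, expD (2 * Real.pi * Complex.I) j a x
        = ((-1 : ℂ) ^ j / 2) * (j ! : ℂ)
          * Complex.exp (-(2 * Real.pi * Complex.I * x))) := by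
  have hlam : (2 * Real.pi * Complex.I : ℂ) ≠ 0 := Complex.two_pi_I_ne_zero
  have h0 : ∀ x : ℝ, expD (2 * Real.pi * Complex.I) 0 a x
      = 1 / 2 * Complex.exp (2 * Real.pi * Complex.I * x)
        + 1 / 2 * Complex.exp (-(2 * Real.pi * Complex.I * x)) := by
    intro x
    rw [expD, ha, Complex.ofReal_cos, Complex.cos]
    push_cast
    ring_nf
  have h1 := expD_succ_of_eq_exp_combination hlam h0
  have h2 := expD_succ_of_eq_exp_combination hlam h1
  refine ⟨ha, fun x => ?_, fun j hj => ?_⟩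
  · rw [h1, Complex.ofReal_sin, Complex.sin]
    push_cast
    ring_nf
    rw [Complex.I_sq]
    ring
  · induction j, hj using Nat.le_induction with
    | base =>
      intro x
      rw [h2]
      simp [Nat.factorial]
      ring
    | succ j hj ih =>
      intro x
      rw [expD_succ_of_eq_exp_combination hlam (c := 0) (fun x => by rw [ih x, zero_mul, zero_add]),
        Nat.factorial_succ]
      push_cast
      ring
end

section
/- For every k ∈ ℕ, Σ_{j=k}^{∞} S^{(k)}_{(j)} / j! = (log 2)^k / k!, where the series converges and log is the natural logarithm. -/
open Real Filter Finset Nat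

/-- The signed Stirling numbers of the first kind `S^{(k)}_{(n)}`, defined as the
coefficients of the falling factorial polynomial:
`x(x−1)⋯(x−n+1) = Σ_{k=0}^{n} S^{(k)}_{(n)} x^k`. -/
noncomputable def stirlingFst (n k : ℕ) : ℤ := (descPochhammer ℤ n).coeff k

theorem stirlingFst_zero_left (k : ℕ) : stirlingFst 0 k = if k = 0 then 1 else 0 := by
  simp [stirlingFst, Polynomial.coeff_one]

theorem stirlingFst_succ_zero (n : ℕ) : stirlingFst (n + 1) 0 = 0 := by
  rw [stirlingFst, Polynomial.coeff_zero_eq_eval_zero,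
    descPochhammer_ne_zero_eval_zero ℤ n.succ_ne_zero]

theorem stirlingFst_succ_succ (n k : ℕ) :
    stirlingFst (n + 1) (k + 1) = stirlingFst n k - n * stirlingFst n (k + 1) := by
  rw [stirlingFst, descPochhammer_succ_right, ← Polynomial.C_eq_natCast,
    Polynomial.coeff_mul_X_sub_C, mul_comm]
  rfl

theorem natCast_mul_stirlingFst_zero (n : ℕ) : (n : ℤ) * stirlingFst n 0 = 0 := by
  cases n <;> simp [stirlingFst_succ_zero]

theorem stirlingFst_eq_zero_of_lt {n k : ℕ} (h : n < k) : stirlingFst n k = 0 :=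
  Polynomial.coeff_eq_zero_of_natDegree_lt (by rwa [descPochhammer_natDegree])

theorem natCast_mul_stirlingFst_succ_div_factorial (n k : ℕ) :
    (n : ℝ) * ((-1) ^ n * (stirlingFst n (k + 1) / n !)) =
      -∑ m ∈ range n, (-1) ^ m * ((stirlingFst m k : ℝ) / m !) := by
  induction n with
  | zero => simp
  | succ n ih =>
    rw [sum_range_succ, neg_add, ← ih, stirlingFst_succ_succ, Nat.factorial_succ]
    push_cast
    field_simp
    ring

theorem tendsto_stirlingFst_div_factorial_atTop (k : ℕ) :
    Tendsto (fun n : ℕ => (stirlingFst n k : ℝ) / n !) atTop (nhds 0) := by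
  have signed_tendsto : Tendsto (fun n : ℕ => (-1 : ℝ) ^ n * ((stirlingFst n k : ℝ) / n !))
      atTop (nhds 0) := by
    induction k with
    | zero =>
      refine tendsto_const_nhds.congr' ?_
      filter_upwards [eventually_ge_atTop 1] with n hn
      obtain ⟨m, rfl⟩ := Nat.exists_eq_add_of_le' hn
      simp [stirlingFst_succ_zero]
    | succ k ih =>
      have averages := ih.cesaro.neg
      rw [neg_zero] at averages
      refine averages.congr' ?_
      filter_upwards [eventually_ge_atTop 1] with n hn
      have hn' : (n : ℝ) ≠ 0 := by positivity
      rw [← mul_neg, ← natCast_mul_stirlingFst_succ_div_factorial, inv_mul_cancel_left₀ hn']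
  rw [tendsto_zero_iff_abs_tendsto_zero] at signed_tendsto ⊢
  simpa [Function.comp_def, abs_mul] using signed_tendsto

/-- The numerator of the `n`-th derivative of `t ↦ log (1 + t) ^ k / k !`,
whose denominator is `(1 + t) ^ n`. -/
noncomputable def logPowNumerator (n k : ℕ) (t : ℝ) : ℝ :=
  ∑ p ∈ antidiagonal k, stirlingFst n p.1 * (Real.log (1 + t) ^ p.2 / p.2 !)

theorem logPowNumerator_zero_left (k : ℕ) (t : ℝ) :
    logPowNumerator 0 k t = Real.log (1 + t) ^ k / k ! := by
  cases k <;>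
    simp [logPowNumerator, stirlingFst_zero_left, Finset.Nat.sum_antidiagonal_succ]

theorem logPowNumerator_zero_right (n k : ℕ) :
    logPowNumerator n k 0 = stirlingFst n k := by
  cases k <;> simp [logPowNumerator, Finset.Nat.sum_antidiagonal_succ']

theorem logPowNumerator_succ_zero (n : ℕ) (t : ℝ) :
    logPowNumerator (n + 1) 0 t = -n * logPowNumerator n 0 t := by
  have h : (n : ℝ) * stirlingFst n 0 = 0 := mod_cast natCast_mul_stirlingFst_zero n
  simp [logPowNumerator, stirlingFst_succ_zero, h]

theorem logPowNumerator_succ_succ (n k : ℕ) (t : ℝ) :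
    logPowNumerator (n + 1) (k + 1) t =
      logPowNumerator n k t - n * logPowNumerator n (k + 1) t := by
  have h : (n : ℝ) * stirlingFst n 0 = 0 := mod_cast natCast_mul_stirlingFst_zero n
  simp only [logPowNumerator, Finset.Nat.sum_antidiagonal_succ, stirlingFst_succ_succ,
    stirlingFst_succ_zero, mul_add, mul_sum, ← mul_assoc, h]
  push_cast
  simp only [sub_mul, sum_sub_distrib]
  ring

theorem hasDerivAt_log_one_add_pow_div_factorial (k : ℕ) {t : ℝ} (ht : 0 < 1 + t) :
    HasDerivAt (fun t : ℝ => Real.log (1 + t) ^ (k + 1) / (k + 1)!)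
      (Real.log (1 + t) ^ k / k ! / (1 + t)) t := by
  have h := ((((hasDerivAt_id t).const_add 1).log ht.ne').pow (k + 1)).div_const ((k + 1)! : ℝ)
  refine h.congr_deriv ?_
  rw [Nat.factorial_succ]
  push_cast
  simp only [id]
  field_simp

theorem hasDerivAt_logPowNumerator_zero (n : ℕ) (t : ℝ) :
    HasDerivAt (logPowNumerator n 0) 0 t := by
  have h : logPowNumerator n 0 = fun _ => (stirlingFst n 0 : ℝ) := by
    ext
    simp [logPowNumerator]
  rw [h]
  exact hasDerivAt_const _ _

theorem hasDerivAt_logPowNumerator_succ (n k : ℕ) {t : ℝ} (ht : 0 < 1 + t) :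
    HasDerivAt (logPowNumerator n (k + 1)) (logPowNumerator n k t / (1 + t)) t := by
  have h : logPowNumerator n (k + 1) = fun t => stirlingFst n (k + 1) +
      ∑ p ∈ antidiagonal k,
        stirlingFst n p.1 * (Real.log (1 + t) ^ (p.2 + 1) / (p.2 + 1)!) := by
    ext
    simp [logPowNumerator, Finset.Nat.sum_antidiagonal_succ']
  rw [h, logPowNumerator, sum_div]
  simp only [mul_div_assoc (stirlingFst n _ : ℝ)]
  exact (HasDerivAt.fun_sum fun p _ =>
    (hasDerivAt_log_one_add_pow_div_factorial p.2 ht).const_mul _).const_add _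

theorem hasDerivAt_logPowNumerator_div_pow (n k : ℕ) {t : ℝ} (ht : 0 < 1 + t) :
    HasDerivAt (fun t => logPowNumerator n k t / (1 + t) ^ n)
      (logPowNumerator (n + 1) k t / (1 + t) ^ (n + 1)) t := by
  have hpow : HasDerivAt (fun t : ℝ => (1 + t) ^ n) (n * (1 + t) ^ (n - 1)) t := by
    simpa using ((hasDerivAt_id t).const_add 1).fun_pow n
  have hpow_pred : (n : ℝ) * (1 + t) ^ (n - 1) = n * (1 + t) ^ n / (1 + t) := by
    cases n
    · simp
    · rw [Nat.add_sub_cancel, pow_succ]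
      field_simp
  rw [hpow_pred] at hpow
  cases k with
  | zero =>
    refine ((hasDerivAt_logPowNumerator_zero n t).fun_div hpow (by positivity)).congr_deriv ?_
    rw [logPowNumerator_succ_zero]
    field_simp
    ring
  | succ k =>
    refine ((hasDerivAt_logPowNumerator_succ n k ht).fun_div hpow (by positivity)).congr_deriv ?_
    rw [logPowNumerator_succ_succ]
    field_simp
    ring

theorem iteratedDerivWithin_log_one_add_pow_div_factorial (n k : ℕ) {t : ℝ}
    (ht : t ∈ Set.Icc (0 : ℝ) 1) :
    iteratedDerivWithin n (fun t : ℝ => Real.log (1 + t) ^ k / k !) (Set.Icc 0 1) t =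
      logPowNumerator n k t / (1 + t) ^ n := by
  induction n generalizing t with
  | zero => simp [logPowNumerator_zero_left]
  | succ n ih =>
    rw [iteratedDerivWithin_succ, derivWithin_congr (fun s hs => ih hs) (ih ht)]
    exact (hasDerivAt_logPowNumerator_div_pow n k (by linarith [ht.1])).hasDerivWithinAt.derivWithin
      (uniqueDiffOn_Icc_zero_one t ht)

theorem abs_logPowNumerator_le (n k : ℕ) {t : ℝ} (ht : t ∈ Set.Icc (0 : ℝ) 1) :
    |logPowNumerator n k t| ≤ ∑ p ∈ antidiagonal k, |(stirlingFst n p.1 : ℝ)| := by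
  have hlog_nonneg : 0 ≤ Real.log (1 + t) := Real.log_nonneg (by linarith [ht.1])
  have hlog_le : Real.log (1 + t) ≤ 1 := by
    linarith [Real.log_le_sub_one_of_pos (show 0 < 1 + t by linarith [ht.1]), ht.2]
  refine (abs_sum_le_sum_abs _ _).trans (sum_le_sum fun p _ => ?_)
  rw [abs_mul]
  refine mul_le_of_le_one_right (abs_nonneg _) ?_
  rw [abs_of_nonneg (by positivity)]
  exact div_le_one_of_le₀ ((pow_le_one₀ hlog_nonneg hlog_le).trans
    (mod_cast Nat.one_le_iff_ne_zero.2 (Nat.factorial_ne_zero _))) (by positivity)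

theorem abs_log_two_pow_div_factorial_sub_sum_le (k N : ℕ) :
    |Real.log 2 ^ k / (k ! : ℝ) - ∑ j ∈ range (N + 1), (stirlingFst j k : ℝ) / (j ! : ℝ)| ≤
      ∑ p ∈ antidiagonal k, |(stirlingFst (N + 1) p.1 : ℝ) / (N + 1)!| := by
  set f : ℝ → ℝ := fun t => Real.log (1 + t) ^ k / k ! with hf
  have hIcc : Set.uIcc (0 : ℝ) 1 = Set.Icc 0 1 := Set.uIcc_of_le zero_le_one
  have hIoo : Set.uIoo (0 : ℝ) 1 = Set.Ioo 0 1 := Set.uIoo_of_le zero_le_one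
  have hsmooth : ContDiffOn ℝ N f (Set.uIcc 0 1) := by
    rw [hIcc]
    refine ContDiffOn.div_const (ContDiffOn.pow (ContDiffOn.log (by fun_prop) ?_) k) _
    intro t ht
    linarith [ht.1]
  have hdiff : DifferentiableOn ℝ (iteratedDerivWithin N f (Set.uIcc 0 1)) (Set.uIoo 0 1) := by
    rw [hIcc, hIoo]
    refine DifferentiableOn.congr (f := fun t => logPowNumerator N k t / (1 + t) ^ N) ?_
      fun t ht => iteratedDerivWithin_log_one_add_pow_div_factorial N k
        (Set.Ioo_subset_Icc_self ht)
    intro t ht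
    exact (hasDerivAt_logPowNumerator_div_pow N k
      (by linarith [ht.1])).differentiableAt.differentiableWithinAt
  obtain ⟨t, ht, hremainder⟩ := taylor_mean_remainder_lagrange zero_ne_one hsmooth hdiff
  rw [hIoo] at ht
  have htIcc := Set.Ioo_subset_Icc_self ht
  have htaylor : taylorWithinEval f N (Set.Icc 0 1) 0 1 =
      ∑ j ∈ range (N + 1), (stirlingFst j k : ℝ) / j ! := by
    rw [taylor_within_apply]
    refine sum_congr rfl fun j _ => ?_
    rw [hf, iteratedDerivWithin_log_one_add_pow_div_factorial j k (by simp),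
      logPowNumerator_zero_right]
    simp [div_eq_inv_mul]
  have hf_one : f 1 = Real.log 2 ^ k / k ! := by norm_num [hf]
  rw [hIcc, htaylor, hf_one, hf,
    iteratedDerivWithin_log_one_add_pow_div_factorial _ k htIcc] at hremainder
  rw [hremainder, sub_zero, one_pow, mul_one]
  simp only [abs_div, Nat.abs_cast, ← sum_div]
  gcongr
  have hpow : 1 ≤ |(1 + t) ^ (N + 1)| :=
    (one_le_pow₀ (by linarith [ht.1])).trans (le_abs_self _)
  exact (div_le_self (abs_nonneg _) hpow).trans (abs_logPowNumerator_le _ _ htIcc)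

theorem sum_Icc_stirlingFst_div_factorial (k N : ℕ) :
    ∑ j ∈ Finset.Icc k N, (stirlingFst j k : ℝ) / (j ! : ℝ) =
      ∑ j ∈ range (N + 1), (stirlingFst j k : ℝ) / (j ! : ℝ) := by
  refine sum_subset (fun j hj => by simp at hj ⊢; omega) fun j hj hjk => ?_
  have hlt : j < k := by simp at hj hjk; omega
  simp [stirlingFst_eq_zero_of_lt hlt]

theorem sum_stirlingFst_div_factorial (k : ℕ) :
    Filter.Tendsto
      (fun N : ℕ => ∑ j ∈ Finset.Icc k N, (stirlingFst j k : ℝ) / (j ! : ℝ))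
      atTop (nhds ((Real.log 2) ^ k / (k ! : ℝ))) := by
  simp only [sum_Icc_stirlingFst_div_factorial]
  have hbound : Tendsto (fun N : ℕ =>
      ∑ p ∈ antidiagonal k, |(stirlingFst (N + 1) p.1 : ℝ) / (N + 1)!|) atTop (nhds 0) := by
    rw [← sum_const_zero (s := antidiagonal k)]
    refine tendsto_finsetSum _ fun p _ => ?_
    simpa using ((tendsto_stirlingFst_div_factorial_atTop p.1).comp (tendsto_add_atTop_nat 1)).abs
  refine tendsto_iff_dist_tendsto_zero.2 (squeeze_zero (fun _ => dist_nonneg) (fun N => ?_) hbound)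
  rw [_root_.dist_comm, Real.dist_eq]
  exact abs_log_two_pow_div_factorial_sub_sum_le k N
end

section
/- Let n ∈ ℕ, n ≥ 1, let U₁, …, Uₙ ⊂ ℝ be open intervals, a ∈ C^∞(U₁ × ⋯ × Uₙ, ℂ), λ ∈ ℂ \ {0}, and x̃ ∈ U₁ × ⋯ × Uₙ. Suppose there exist a neighbourhood V ⊂ U₁ × ⋯ × Uₙ of x̃ and A ≥ 0 such that sup_{y ∈ V} |(D^{λ,(γ)}a)(y)| ≤ A·γ! for every multi-index γ ∈ ℕ₀ⁿ. Then there exists δ > 0 such that for every x with ‖x − x̃‖_∞ < δ, a(x) = Σ_{γ ∈ ℕ₀ⁿ} (1/γ!) (D^{λ,(γ)}a)(x̃) (e^{λ(x−x̃)} − 1)^γ, with the series converging (summable over all multi-indices γ). -/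
open Complex Filter Finset Nat

/-- The one-variable differential operator `D^{λ,(j)}` applied in the `i`-th coordinate
of a function `(Fin n → ℝ) → ℂ`: `D^{λ,(0)} = Id` and
`D^{λ,(j+1)} = ((1/λ)·∂/∂xᵢ − j·Id) ∘ D^{λ,(j)}`. -/
noncomputable def pD {n : ℕ} (lam : ℂ) (i : Fin n) :
    ℕ → ((Fin n → ℝ) → ℂ) → ((Fin n → ℝ) → ℂ)
  | 0, a => a
  | (j + 1), a => fun x =>
      (1 / lam) * deriv (fun t => pD lam i j a (Function.update x i t)) (x i)
        - (j : ℂ) * pD lam i j a x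

/-- The multi-index operator `D^{λ,(γ)} = D_{x₁}^{λ,(γ₁)} ⋯ D_{xₙ}^{λ,(γₙ)}`. -/
noncomputable def expDm {n : ℕ} (lam : ℂ) (γ : Fin n → ℕ)
    (a : (Fin n → ℝ) → ℂ) : (Fin n → ℝ) → ℂ :=
  (List.finRange n).foldr (fun i g => pD lam i (γ i) g) a

/-- Finite expansion in powers of `exp (lam * (s - t)) - 1`: its derivative in the base point `t`
telescopes. -/
lemma hasDerivWithinAt_expTaylorSum (lam : ℂ) (g : ℕ → ℝ → ℂ) (s t : ℝ) (I : Set ℝ)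
    (hg : ∀ j, HasDerivWithinAt (g j) (lam * (g (j + 1) t + j * g j t)) I t) (N : ℕ) :
    HasDerivWithinAt
      (fun t : ℝ => ∑ j ∈ range (N + 1),
        1 / (j ! : ℂ) * g j t * (Complex.exp (lam * (s - t)) - 1) ^ j)
      (lam * (1 / (N ! : ℂ) * g (N + 1) t * (Complex.exp (lam * (s - t)) - 1) ^ N)) I t := by
  have hw : HasDerivWithinAt (fun t : ℝ => Complex.exp (lam * (s - t)) - 1)
      (Complex.exp (lam * (s - t)) * (lam * (-1))) I t := by
    have h1 : HasDerivAt (fun t : ℝ => (t : ℂ)) 1 t := Complex.ofRealCLM.hasDerivAt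
    exact (((h1.const_sub (s : ℂ)).const_mul lam).cexp.sub_const 1).hasDerivWithinAt
  induction N with
  | zero => simpa using hg 0
  | succ N ih =>
    simp_rw [sum_range_succ _ (N + 1)]
    refine (ih.add (((hg (N + 1)).const_mul (1 / ((N + 1)! : ℂ))).mul
      (hw.pow (N + 1)))).congr_deriv ?_
    have hN : (N ! : ℂ) ≠ 0 := by exact_mod_cast N.factorial_ne_zero
    have hN1 : (N : ℂ) + 1 ≠ 0 := by exact_mod_cast N.succ_ne_zero
    simp only [Nat.factorial_succ, Nat.cast_mul, Nat.cast_add, Nat.cast_one, Nat.add_sub_cancel, Pi.pow_apply]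
    field_simp
    ring

/-- One-variable expansion in powers of `exp (lam * (s - s₀)) - 1`. -/
lemma hasSum_expTaylor (lam : ℂ) (g : ℕ → ℝ → ℂ) (s₀ s C : ℝ)
    (hg : ∀ j, ∀ t ∈ Set.uIcc s₀ s,
      HasDerivWithinAt (g j) (lam * (g (j + 1) t + j * g j t)) (Set.uIcc s₀ s) t)
    (hC : ∀ j, ∀ t ∈ Set.uIcc s₀ s, ‖g j t‖ ≤ C * (j ! : ℝ))
    (hw : ∀ t ∈ Set.uIcc s₀ s, ‖Complex.exp (lam * (s - t)) - 1‖ ≤ 1 / 2) :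
    HasSum (fun j => 1 / (j ! : ℂ) * g j s₀ * (Complex.exp (lam * (s - s₀)) - 1) ^ j)
      (g 0 s) := by
  have hs₀ : s₀ ∈ Set.uIcc s₀ s := Set.left_mem_uIcc
  have hs : s ∈ Set.uIcc s₀ s := Set.right_mem_uIcc
  have hC0 : 0 ≤ C := by simpa using (norm_nonneg _).trans (hC 0 s₀ hs₀)
  have hterm : ∀ j, ‖1 / (j ! : ℂ) * g j s₀ * (Complex.exp (lam * (s - s₀)) - 1) ^ j‖
      ≤ C * (1 / 2) ^ j := by
    intro j
    have hj : (0 : ℝ) < j ! := by exact_mod_cast j.factorial_pos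
    rw [norm_mul, norm_mul, norm_pow, norm_div, norm_one, Complex.norm_natCast]
    gcongr
    · rw [one_div, inv_mul_le_iff₀ hj, mul_comm]
      exact hC j s₀ hs₀
    · exact hw s₀ hs₀
  have hsum : Summable fun j =>
      ‖1 / (j ! : ℂ) * g j s₀ * (Complex.exp (lam * (s - s₀)) - 1) ^ j‖ :=
    Summable.of_nonneg_of_le (fun _ => norm_nonneg _) hterm
      ((summable_geometric_of_lt_one (by norm_num) (by norm_num)).mul_left C)
  rw [hasSum_iff_tendsto_nat_of_summable_norm hsum, ← tendsto_add_atTop_iff_nat 1,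
    tendsto_iff_norm_sub_tendsto_zero]
  have hlim : Tendsto (fun N : ℕ => ‖lam‖ * C * |s₀ - s| * ((N + 1 : ℝ) * (1 / 2) ^ N))
      atTop (nhds 0) := by
    have h1 := tendsto_self_mul_const_pow_of_lt_one (r := (1 / 2 : ℝ)) (by norm_num) (by norm_num)
    have h2 := tendsto_pow_atTop_nhds_zero_of_lt_one (r := (1 / 2 : ℝ)) (by norm_num) (by norm_num)
    simpa [add_mul] using (h1.add h2).const_mul (‖lam‖ * C * |s₀ - s|)
  refine squeeze_zero (fun _ => norm_nonneg _) (fun N => ?_) hlim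
  have hmv := (convex_uIcc s₀ s).norm_image_sub_le_of_norm_hasDerivWithin_le
    (C := ‖lam‖ * C * ((N + 1 : ℝ) * (1 / 2) ^ N))
    (fun t ht => hasDerivWithinAt_expTaylorSum lam g s t _ (fun j => hg j t ht) N)
    (fun t ht => ?_) hs hs₀
  · have hend : ∑ j ∈ range (N + 1),
        1 / (j ! : ℂ) * g j s * (Complex.exp (lam * (s - s)) - 1) ^ j = g 0 s := by
      simp [sum_range_succ']
    rw [hend] at hmv
    refine hmv.trans (le_of_eq ?_)
    rw [Real.norm_eq_abs]
    ring
  · have hN : (0 : ℝ) < N ! := by exact_mod_cast N.factorial_pos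
    rw [norm_mul, norm_mul, norm_mul, norm_pow, norm_div, norm_one, Complex.norm_natCast,
      mul_assoc ‖lam‖ C, ← mul_assoc C]
    have hg1 : 1 / (N ! : ℝ) * ‖g (N + 1) t‖ ≤ C * (N + 1) := ?_
    · gcongr
      exact hw t ht
    · rw [one_div, inv_mul_le_iff₀ hN]
      refine (hC (N + 1) t ht).trans (le_of_eq ?_)
      rw [Nat.factorial_succ]
      push_cast
      ring

lemma ContDiffOn.hasDerivAt_update {n : ℕ} {W : Set (Fin n → ℝ)} (hW : IsOpen W)
    {f : (Fin n → ℝ) → ℂ} (hf : ContDiffOn ℝ (⊤ : ℕ∞) f W) (i : Fin n) (x : Fin n → ℝ) (t : ℝ)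
    (hx : Function.update x i t ∈ W) :
    HasDerivAt (fun t => f (Function.update x i t))
      (fderiv ℝ f (Function.update x i t) (Pi.single i 1)) t :=
  ((hf.differentiableOn (by simp)).differentiableAt
    (hW.mem_nhds hx)).hasFDerivAt.comp_hasDerivAt t (_root_.hasDerivAt_update x i t)

lemma ContDiffOn.pD {n : ℕ} {W : Set (Fin n → ℝ)} (hW : IsOpen W)
    {f : (Fin n → ℝ) → ℂ} (hf : ContDiffOn ℝ (⊤ : ℕ∞) f W) (lam : ℂ) (i : Fin n) (j : ℕ) :
    ContDiffOn ℝ (⊤ : ℕ∞) (pD lam i j f) W := by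
  induction j with
  | zero => exact hf
  | succ j ih =>
    have hd : ContDiffOn ℝ (⊤ : ℕ∞)
        (fun x => fderiv ℝ (_root_.pD lam i j f) x (Pi.single i 1)) W :=
      (ih.fderiv_of_isOpen hW (by simp)).clm_apply contDiffOn_const
    refine (((contDiffOn_const (c := 1 / lam)).mul hd).sub
      ((contDiffOn_const (c := (j : ℂ))).mul ih)).congr fun x hx => ?_
    have h := ih.hasDerivAt_update hW i x (x i) (by simpa using hx)
    simp [_root_.pD, h.deriv]

lemma hasDerivAt_pD_update {n : ℕ} {W : Set (Fin n → ℝ)} (hW : IsOpen W)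
    {f : (Fin n → ℝ) → ℂ} (hf : ContDiffOn ℝ (⊤ : ℕ∞) f W) {lam : ℂ} (hlam : lam ≠ 0)
    (i : Fin n) (j : ℕ) (x : Fin n → ℝ) (t : ℝ) (hx : Function.update x i t ∈ W) :
    HasDerivAt (fun t => pD lam i j f (Function.update x i t))
      (lam * (pD lam i (j + 1) f (Function.update x i t)
        + j * pD lam i j f (Function.update x i t))) t := by
  have h := (hf.pD hW lam i j).hasDerivAt_update hW i x t hx
  refine h.congr_deriv ?_
  simp [pD, h.deriv, hlam]

lemma update_mem_ball {n : ℕ} {x c : Fin n → ℝ} {δ : ℝ} (hx : x ∈ Metric.ball c δ)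
    (i : Fin n) {t : ℝ} (ht : |t - c i| < δ) : Function.update x i t ∈ Metric.ball c δ := by
  have hδ : 0 < δ := (abs_nonneg _).trans_lt ht
  rw [Metric.mem_ball, dist_pi_lt_iff hδ] at hx ⊢
  intro k
  rcases eq_or_ne k i with rfl | hk
  · simpa [Real.dist_eq] using ht
  · simpa [hk] using hx k

/-- Expansion in the `i`-th variable around the centre of a ball. -/
lemma hasSum_pD {n : ℕ} {c : Fin n → ℝ} {δ : ℝ} {f : (Fin n → ℝ) → ℂ}
    (hf : ContDiffOn ℝ (⊤ : ℕ∞) f (Metric.ball c δ)) {lam : ℂ} (hlam : lam ≠ 0)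
    (hδ : ∀ s : ℝ, |s| < δ → ‖Complex.exp (lam * s) - 1‖ ≤ 1 / 2) (i : Fin n) (C : ℝ)
    (hC : ∀ j, ∀ y ∈ Metric.ball c δ, ‖pD lam i j f y‖ ≤ C * (j ! : ℝ))
    (x : Fin n → ℝ) (hx : x ∈ Metric.ball c δ) :
    HasSum (fun j => 1 / (j ! : ℂ) * pD lam i j f (Function.update x i (c i))
      * (Complex.exp (lam * (x i - c i)) - 1) ^ j) (f x) := by
  have hxi : |x i - c i| < δ := (dist_le_pi_dist x c i).trans_lt hx
  have hmem : ∀ t ∈ Set.uIcc (c i) (x i), Function.update x i t ∈ Metric.ball c δ := fun t ht =>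
    update_mem_ball hx i ((Set.abs_sub_left_of_mem_uIcc ht).trans_lt hxi)
  have h := hasSum_expTaylor lam (fun j t => pD lam i j f (Function.update x i t)) (c i) (x i) C
    (fun j t ht => (hasDerivAt_pD_update Metric.isOpen_ball hf hlam i j x t
      (hmem t ht)).hasDerivWithinAt)
    (fun j t ht => hC j _ (hmem t ht))
    (fun t ht => by
      simpa using hδ (x i - t) ((Set.abs_sub_right_of_mem_uIcc ht).trans_lt hxi))
  simpa [pD] using h

lemma summable_prod_pow {m : ℕ} (r : Fin m → ℝ) (h0 : ∀ i, 0 ≤ r i) (h1 : ∀ i, r i < 1) :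
    Summable fun γ : Fin m → ℕ => ∏ i, r i ^ γ i := by
  induction m with
  | zero => exact (hasSum_fintype _).summable
  | succ m ih =>
    rw [← (Fin.consEquiv fun _ : Fin (m + 1) => ℕ).summable_iff]
    have h := (summable_geometric_of_lt_one (h0 0) (h1 0)).mul_of_nonneg
      (ih (fun i => r i.succ) (fun i => h0 _) (fun i => h1 _))
      (fun _ => pow_nonneg (h0 0) _)
      (fun γ => Finset.prod_nonneg fun i _ => pow_nonneg (h0 _) _)
    refine h.congr fun p => ?_
    simp [Fin.consEquiv, Fin.prod_univ_succ]

lemma hasSum_of_fin_cons {m : ℕ} {F : (Fin (m + 1) → ℕ) → ℂ} {G : (Fin m → ℕ) → ℂ} {b : ℂ}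
    (hF : Summable F) (hfib : ∀ γ, HasSum (fun j : ℕ => F (Fin.cons j γ)) (G γ))
    (hG : HasSum G b) : HasSum F b := by
  let e : (Fin m → ℕ) × ℕ ≃ (Fin (m + 1) → ℕ) :=
    (Equiv.prodComm (Fin m → ℕ) ℕ).trans (Fin.consEquiv fun _ => ℕ)
  have htot := (e.summable_iff.2 hF).hasSum
  rw [(htot.prod_fiberwise hfib).unique hG] at htot
  exact e.hasSum_iff.1 htot

/-- The composition `D_{c 0}^{(γ 0)} ⋯ D_{c (m-1)}^{(γ (m-1))}` along the coordinates listed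
by `c`. -/
noncomputable def expDmAlong {n m : ℕ} (lam : ℂ) (c : Fin m → Fin n) (γ : Fin m → ℕ)
    (a : (Fin n → ℝ) → ℂ) : (Fin n → ℝ) → ℂ :=
  (List.finRange m).foldr (fun i g => pD lam (c i) (γ i) g) a

lemma expDmAlong_succ {n m : ℕ} (lam : ℂ) (c : Fin (m + 1) → Fin n) (γ : Fin (m + 1) → ℕ)
    (a : (Fin n → ℝ) → ℂ) :
    expDmAlong lam c γ a
      = pD lam (c 0) (γ 0) (expDmAlong lam (fun i : Fin m => c i.succ) (fun i => γ i.succ) a) := by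
  simp [expDmAlong, List.finRange_succ, List.foldr_map]

lemma ContDiffOn.expDmAlong {n m : ℕ} {W : Set (Fin n → ℝ)} (hW : IsOpen W)
    {a : (Fin n → ℝ) → ℂ} (ha : ContDiffOn ℝ (⊤ : ℕ∞) a W) (lam : ℂ) (c : Fin m → Fin n)
    (γ : Fin m → ℕ) : ContDiffOn ℝ (⊤ : ℕ∞) (expDmAlong lam c γ a) W := by
  induction m with
  | zero => simpa [_root_.expDmAlong] using ha
  | succ m ih =>
    rw [expDmAlong_succ]
    exact (ih _ _).pD hW lam _ _

/-- Expansion in the variables listed by `c`, the other ones being left untouched. -/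
lemma hasSum_expDmAlong {n m : ℕ} {z : Fin n → ℝ} {δ : ℝ} {a : (Fin n → ℝ) → ℂ}
    (ha : ContDiffOn ℝ (⊤ : ℕ∞) a (Metric.ball z δ)) {lam : ℂ} (hlam : lam ≠ 0)
    (hδ : ∀ s : ℝ, |s| < δ → ‖Complex.exp (lam * s) - 1‖ ≤ 1 / 2)
    (c : Fin m → Fin n) (hc : Function.Injective c) (A : ℝ)
    (hbound : ∀ γ : Fin m → ℕ, ∀ y ∈ Metric.ball z δ,
      ‖expDmAlong lam c γ a y‖ ≤ A * ∏ i, ((γ i)! : ℝ))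
    (x y : Fin n → ℝ) (hx : x ∈ Metric.ball z δ) (hy : ∀ i, y (c i) = z (c i))
    (hyx : ∀ k ∉ Set.range c, y k = x k) :
    HasSum (fun γ : Fin m → ℕ =>
      (1 / (∏ i, ((γ i)! : ℂ))) * expDmAlong lam c γ a y
        * ∏ i, (Complex.exp (lam * (x (c i) - z (c i))) - 1) ^ γ i) (a x) := by
  induction m generalizing y with
  | zero =>
    obtain rfl : y = x := funext fun k => hyx k (by simp)
    simp [expDmAlong]
  | succ m ih =>
    have hx' : ∀ k, |x k - z k| < δ := fun k => (dist_le_pi_dist x z k).trans_lt hx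
    have hw : ∀ k, ‖Complex.exp (lam * (x k - z k)) - 1‖ ≤ 1 / 2 := fun k => by
      simpa using hδ (x k - z k) (hx' k)
    have hδ0 : 0 < δ := dist_nonneg.trans_lt hx
    have hyb : y ∈ Metric.ball z δ := by
      rw [Metric.mem_ball, dist_pi_lt_iff hδ0]
      intro k
      by_cases hk : k ∈ Set.range c
      · obtain ⟨i, rfl⟩ := hk
        simpa [hy] using hδ0
      · simpa [hyx k hk, Real.dist_eq] using hx' k
    have hsum : Summable fun γ : Fin (m + 1) → ℕ =>
        (1 / (∏ i, ((γ i)! : ℂ))) * expDmAlong lam c γ a y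
          * ∏ i, (Complex.exp (lam * (x (c i) - z (c i))) - 1) ^ γ i := by
      refine Summable.of_norm_bounded ((summable_prod_pow
        (fun i => ‖Complex.exp (lam * (x (c i) - z (c i))) - 1‖) (fun _ => norm_nonneg _)
        (fun i => (hw (c i)).trans_lt (by norm_num))).mul_left A) fun γ => ?_
      have hγ : (0 : ℝ) < ∏ i, ((γ i)! : ℝ) :=
        Finset.prod_pos fun i _ => by exact_mod_cast (γ i).factorial_pos
      simp only [norm_mul, norm_div, norm_one, norm_prod, norm_pow, Complex.norm_natCast]
      gcongr
      rw [one_div, inv_mul_le_iff₀ hγ, mul_comm]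
      exact hbound γ _ hyb
    have hc0 : ∀ i : Fin m, c i.succ ≠ c 0 := fun i h => Fin.succ_ne_zero i (hc h)
    set y' := Function.update y (c 0) (x (c 0)) with hy'
    have hy'b : y' ∈ Metric.ball z δ := update_mem_ball hyb (c 0) (hx' (c 0))
    have hih := ih (fun i => c i.succ) (hc.comp (Fin.succ_injective m))
      (fun γ y hy => by
        simpa [expDmAlong_succ, pD, Fin.prod_univ_succ] using hbound (Fin.cons 0 γ) y hy)
      y' (fun i => by simp [hy', hc0, hy]) (fun k hk => by
        rcases eq_or_ne k (c 0) with rfl | hk0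
        · simp [hy']
        · rw [hy', Function.update_of_ne hk0]
          refine hyx k ?_
          rintro ⟨i, rfl⟩
          cases i using Fin.cases with
          | zero => exact hk0 rfl
          | succ i => exact hk ⟨i, rfl⟩)
    refine hasSum_of_fin_cons hsum (fun γ => ?_) hih
    have h1 := hasSum_pD (ha.expDmAlong Metric.isOpen_ball lam (fun i : Fin m => c i.succ) γ) hlam
      hδ (c 0) (A * ∏ i, ((γ i)! : ℝ)) (fun j y hy => by
        have := hbound (Fin.cons j γ) y hy
        simp only [expDmAlong_succ, Fin.cons_zero, Fin.cons_succ, Fin.prod_univ_succ] at this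
        linarith) y' hy'b
    have hback : Function.update y' (c 0) (z (c 0)) = y := by
      rw [hy', Function.update_idem, ← hy 0, Function.update_eq_self]
    rw [hback, show y' (c 0) = x (c 0) by simp [hy']] at h1
    have h2 := (h1.mul_left (1 / (∏ i, ((γ i)! : ℂ)))).mul_right
      (∏ i : Fin m, (Complex.exp (lam * (x (c i.succ) - z (c i.succ))) - 1) ^ γ i)
    refine (congrArg (HasSum · _) (funext fun j => ?_)).mp h2
    simp only [expDmAlong_succ, Fin.cons_zero, Fin.cons_succ, Fin.prod_univ_succ]
    rw [← one_div_mul_one_div (j ! : ℂ)]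
    ring

theorem multivariable_exp_taylor_series_hasSum
    (n : ℕ) (hn : 1 ≤ n) (U : Fin n → Set ℝ)
    (hU : ∀ i, IsOpen (U i)) (hU' : ∀ i, (U i).OrdConnected)
    (a : (Fin n → ℝ) → ℂ) (ha : ContDiffOn ℝ (⊤ : ℕ∞) a (Set.univ.pi U))
    (lam : ℂ) (hlam : lam ≠ 0)
    (xt : Fin n → ℝ) (hxt : xt ∈ Set.univ.pi U)
    (V : Set (Fin n → ℝ)) (hV : V ∈ nhds xt) (hVU : V ⊆ Set.univ.pi U)
    (A : ℝ) (hA : 0 ≤ A)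
    (hbound : ∀ γ : Fin n → ℕ, ∀ y ∈ V, ‖expDm lam γ a y‖ ≤ A * ∏ i, ((γ i)! : ℝ)) :
    ∃ δ > 0, ∀ x : Fin n → ℝ, ‖x - xt‖ < δ →
      HasSum (fun γ : Fin n → ℕ =>
        (1 / (∏ i, ((γ i)! : ℂ))) * expDm lam γ a xt
          * ∏ i, (Complex.exp (lam * (x i - xt i)) - 1) ^ γ i) (a x) := by
  have hcont : Tendsto (fun s : ℝ => ‖Complex.exp (lam * s) - 1‖) (nhds 0) (nhds 0) := by
    have h : Continuous fun s : ℝ => ‖Complex.exp (lam * s) - 1‖ := by fun_prop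
    simpa using h.tendsto 0
  obtain ⟨δ₁, hδ₁, h₁⟩ := Metric.eventually_nhds_iff.1
    (hcont.eventually_le_const (by norm_num : (0 : ℝ) < 1 / 2))
  obtain ⟨δ₂, hδ₂, h₂⟩ := Metric.mem_nhds_iff.1 hV
  have hball : Metric.ball xt (min δ₁ δ₂) ⊆ V :=
    (Metric.ball_subset_ball (min_le_right _ _)).trans h₂
  refine ⟨min δ₁ δ₂, lt_min hδ₁ hδ₂, fun x hx => ?_⟩
  have h := hasSum_expDmAlong (ha.mono (hball.trans hVU)) hlam
    (fun s hs => h₁ (by simpa using hs.trans_le (min_le_left _ _))) id Function.injective_id A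
    (fun γ y hy => hbound γ y (hball hy)) x xt
    (mem_ball_iff_norm.2 hx) (fun _ => rfl) (fun k hk => absurd ⟨k, rfl⟩ hk)
  simpa [expDmAlong, expDm] using h
end
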